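/- ODE for the missing branch: let 1 ≤ i₀ ≤ n and suppose C¹ expanding branches f_i on I_i are given for all i ≠ i₀ satisfying Σ_{i≠i₀} 1/(f_i'(f_i⁻¹(x))) < 1 for every x ∈ [0,1]. Then the unique C¹ expanding branch f_{i₀} on I_{i₀} making the full branch map Lebesgue-measure preserving satisfies f_{i₀}(a_{i₀−1}) = 0 and, for every x ∈ I_{i₀}, f_{i₀}'(x) = ( 1 − Σ_{i≠i₀} 1/( f_i'( f_i⁻¹( f_{i₀}(x) ) ) ) )⁻¹. -/

import Mathlib

open Set MeasureTheory

/-- `g` (with derivative `g'`) is a C¹ expanding branch on the interval `[l, r]`. -/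
def IsBranch (l r : ℝ) (g g' : ℝ → ℝ) : Prop :=
  (∀ x ∈ Set.Icc l r, HasDerivWithinAt g (g' x) (Set.Icc l r) x) ∧
  ContinuousOn g' (Set.Icc l r) ∧
  (∀ x ∈ Set.Icc l r, 1 < g' x) ∧
  g l = 0 ∧ g r = 1

/-- `F` is the full branch map associated to the branches `f i` on the partition `a`. -/
def AgreesWith {n : ℕ} (a : Fin (n + 1) → ℝ) (f : Fin n → ℝ → ℝ) (F : ℝ → ℝ) : Prop :=
  (∀ i : Fin n, ∀ x ∈ Set.Ico (a i.castSucc) (a i.succ), F x = f i x) ∧ F 1 = 1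

/-- `F` preserves Lebesgue measure on `[0,1]`. -/
def PreservesLeb (F : ℝ → ℝ) : Prop :=
  ∀ A : Set ℝ, MeasurableSet A → A ⊆ Set.Icc 0 1 →
    volume (F ⁻¹' A ∩ Set.Icc 0 1) = volume A

/-- A C¹ expanding branch does not decrease distances. -/
theorem IsBranch.sub_le_sub {l r : ℝ} {g g' : ℝ → ℝ} (hg : IsBranch l r g g') {x y : ℝ}
    (hx : x ∈ Icc l r) (hy : y ∈ Icc l r) (hxy : x ≤ y) : y - x ≤ g y - g x := by
  have hderiv : ∀ z ∈ interior (Icc l r), HasDerivAt g (g' z) z := fun z hz =>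
    (hg.1 z (interior_subset hz)).hasDerivAt (mem_interior_iff_mem_nhds.1 hz)
  simpa using (convex_Icc l r).mul_sub_le_image_sub_of_le_deriv (C := 1)
    (fun z hz => (hg.1 z hz).continuousWithinAt)
    (fun z hz => (hderiv z hz).differentiableAt.differentiableWithinAt)
    (fun z hz => (hderiv z hz).deriv ▸ (hg.2.2.1 z (interior_subset hz)).le) x hx y hy hxy

theorem IsBranch.strictMonoOn {l r : ℝ} {g g' : ℝ → ℝ} (hg : IsBranch l r g g') :
    StrictMonoOn g (Icc l r) := fun x hx y hy hxy => by
  linarith [hg.sub_le_sub hx hy hxy.le]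

/-- A C¹ expanding branch maps its interval onto `[0, 1]`. -/
theorem IsBranch.exists_eq {l r : ℝ} {g g' : ℝ → ℝ} (hlr : l ≤ r) (hg : IsBranch l r g g')
    {t : ℝ} (ht : t ∈ Icc (0 : ℝ) 1) : ∃ x ∈ Icc l r, g x = t := by
  obtain ⟨hd, -, -, hl, hr⟩ := hg
  have := intermediate_value_Icc hlr fun z hz => (hd z hz).continuousWithinAt
  rw [hl, hr] at this
  exact this ht

open Filter Topology in
/-- The inverse of a C¹ expanding branch is differentiable, with the reciprocal derivative. -/
theorem IsBranch.hasDerivWithinAt_rightInverse {l r : ℝ} {g g' h : ℝ → ℝ}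
    (hg : IsBranch l r g g')
    (hh : ∀ t ∈ Icc (0 : ℝ) 1, h t ∈ Icc l r ∧ g (h t) = t) {t : ℝ} (ht : t ∈ Icc (0 : ℝ) 1) :
    HasDerivWithinAt h (g' (h t))⁻¹ (Icc 0 1) t := by
  have hlip : LipschitzOnWith 1 h (Icc 0 1) := by
    refine LipschitzOnWith.of_le_add fun s hs u hu => ?_
    obtain ⟨hs1, hs2⟩ := hh s hs
    obtain ⟨hu1, hu2⟩ := hh u hu
    rcases le_total (h s) (h u) with hle | hle
    · linarith [dist_nonneg (x := s) (y := u)]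
    · have := hg.sub_le_sub hu1 hs1 hle
      rw [hs2, hu2] at this
      linarith [le_abs_self (s - u), Real.dist_eq s u]
  have hne : g' (h t) ≠ 0 := (zero_lt_one.trans (hg.2.2.1 _ (hh t ht).1)).ne'
  have htend : Tendsto h (𝓝[Icc 0 1] t) (𝓝[Icc l r] (h t)) :=
    tendsto_nhdsWithin_iff.2 ⟨hlip.continuousOn t ht,
      eventually_mem_nhdsWithin.mono fun s hs => (hh s hs).1⟩
  have hfd : HasFDerivWithinAt g
      ((ContinuousLinearEquiv.unitsEquivAut ℝ (Units.mk0 _ hne) : ℝ ≃L[ℝ] ℝ) : ℝ →L[ℝ] ℝ)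
      (Icc l r) (h t) := hg.1 _ (hh t ht).1
  simpa using (hfd.of_local_left_inverse htend ht
    (eventually_mem_nhdsWithin.mono fun s hs => (hh s hs).2)).hasDerivWithinAt

/-- Every point of `[a 0, a N)` lies in one of the intervals of the partition `a`. -/
theorem exists_mem_Ico_castSucc_succ {N : ℕ} (a : Fin (N + 1) → ℝ) {x : ℝ} (hx0 : a 0 ≤ x)
    (hxN : x < a (Fin.last N)) : ∃ i : Fin N, x ∈ Ico (a i.castSucc) (a i.succ) := by
  by_contra! hne
  have hle : ∀ i, a i ≤ x := fun i => by
    induction i using Fin.induction with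
    | zero => exact hx0
    | succ i ih => exact not_lt.1 fun hlt => hne i ⟨ih, hlt⟩
  exact (hle _).not_gt hxN

theorem disjoint_Ico_castSucc_succ {N : ℕ} {a : Fin (N + 1) → ℝ} (ha : Monotone a) {i j : Fin N}
    (hij : i ≠ j) : Disjoint (Ico (a i.castSucc) (a i.succ)) (Ico (a j.castSucc) (a j.succ)) := by
  wlog hlt : i < j generalizing i j
  · exact (this hij.symm (lt_of_le_of_ne (not_lt.1 hlt) hij.symm)).symm
  refine Set.disjoint_left.2 fun x hx hx' => ?_
  have : a i.succ ≤ a j.castSucc := ha (Fin.succ_le_castSucc_iff.2 hlt)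
  linarith [hx.2, hx'.1]

open Classical in
theorem exists_agreesWith {N : ℕ} {a : Fin (N + 1) → ℝ} (ha : Monotone a)
    (haN : a (Fin.last N) = 1) (f : Fin N → ℝ → ℝ) : ∃ F, AgreesWith a f F := by
  refine ⟨fun x => if hx : ∃ i : Fin N, x ∈ Ico (a i.castSucc) (a i.succ) then f hx.choose x
    else 1, fun i x hx => ?_, dif_neg ?_⟩
  · have hex : ∃ i : Fin N, x ∈ Ico (a i.castSucc) (a i.succ) := ⟨i, hx⟩
    have : hex.choose = i := by
      by_contra hne
      exact Set.disjoint_left.1 (disjoint_Ico_castSucc_succ ha hne) hex.choose_spec hx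
    simp only [dif_pos hex, this]
  · rintro ⟨i, hi⟩
    exact hi.2.not_ge (haN ▸ ha (Fin.le_last _))

/-- The preimage of `[0, t)` under a measure-preserving full branch map has measure `t`, written
in terms of the preimages of `t` under the branches. -/
theorem sum_preimage_sub_eq {N : ℕ} {a : Fin (N + 1) → ℝ} (ha : StrictMono a) (ha0 : a 0 = 0)
    (haN : a (Fin.last N) = 1) {f f' : Fin N → ℝ → ℝ} {F : ℝ → ℝ}
    (hf : ∀ i, IsBranch (a i.castSucc) (a i.succ) (f i) (f' i)) (hF : AgreesWith a f F)
    (hpres : PreservesLeb F) {t : ℝ} (ht : t ∈ Icc (0 : ℝ) 1) {y : Fin N → ℝ}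
    (hy : ∀ i, y i ∈ Icc (a i.castSucc) (a i.succ) ∧ f i (y i) = t) :
    ∑ i, (y i - a i.castSucc) = t := by
  have hlt : ∀ i : Fin N, a i.castSucc < a i.succ := fun i => ha i.castSucc_lt_succ
  have hset : F ⁻¹' Ico 0 t ∩ Icc 0 1 = ⋃ i, Ico (a i.castSucc) (y i) := by
    ext x
    simp only [mem_inter_iff, mem_preimage, mem_iUnion]
    constructor
    · rintro ⟨hFx, hx⟩
      have hx1 : x ≠ 1 := by
        rintro rfl
        rw [hF.2] at hFx
        exact hFx.2.not_ge ht.2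
      obtain ⟨i, hi⟩ := exists_mem_Ico_castSucc_succ a (ha0.trans_le hx.1)
        ((lt_of_le_of_ne hx.2 hx1).trans_eq haN.symm)
      rw [hF.1 i x hi, ← (hy i).2] at hFx
      exact ⟨i, hi.1, ((hf i).strictMonoOn.lt_iff_lt (Ico_subset_Icc_self hi) (hy i).1).1 hFx.2⟩
    · rintro ⟨i, hi⟩
      have hx : x ∈ Ico (a i.castSucc) (a i.succ) := ⟨hi.1, hi.2.trans_le (hy i).1.2⟩
      have hx' := Ico_subset_Icc_self hx
      refine ⟨?_, ?_, ?_⟩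
      · rw [hF.1 i x hx, ← (hy i).2]
        refine ⟨?_, (hf i).strictMonoOn hx' (hy i).1 hi.2⟩
        rw [← (hf i).2.2.2.1]
        exact (hf i).strictMonoOn.monotoneOn (left_mem_Icc.2 (hlt i).le) hx' hx.1
      · exact (ha0.symm.trans_le (ha.monotone (Fin.zero_le _))).trans hx.1
      · exact hx.2.le.trans (haN ▸ ha.monotone (Fin.le_last _))
  have hvol := hpres (Ico 0 t) measurableSet_Ico
    (Ico_subset_Icc_self.trans (Icc_subset_Icc_right ht.2))
  rw [hset, measure_iUnion (fun i j hij => ?_) fun _ => measurableSet_Ico, tsum_fintype] at hvol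
  · simp only [Real.volume_Ico, sub_zero] at hvol
    have hnonneg : ∀ i ∈ Finset.univ, 0 ≤ y i - a i.castSucc := fun i _ =>
      sub_nonneg.2 (hy i).1.1
    rw [← ENNReal.ofReal_sum_of_nonneg hnonneg] at hvol
    exact (ENNReal.ofReal_eq_ofReal_iff (Finset.sum_nonneg hnonneg) ht.1).1 hvol
  · exact (disjoint_Ico_castSucc_succ ha.monotone hij).mono (Ico_subset_Ico_right (hy i).1.2)
      (Ico_subset_Ico_right (hy j).1.2)

/-- A measure-preserving full branch map fixes the constant density under its transfer operator. -/
theorem sum_inv_deriv_eq_one {N : ℕ} {a : Fin (N + 1) → ℝ} (ha : StrictMono a) (ha0 : a 0 = 0)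
    (haN : a (Fin.last N) = 1) {f f' : Fin N → ℝ → ℝ} {F : ℝ → ℝ}
    (hf : ∀ i, IsBranch (a i.castSucc) (a i.succ) (f i) (f' i)) (hF : AgreesWith a f F)
    (hpres : PreservesLeb F) {t : ℝ} (ht : t ∈ Icc (0 : ℝ) 1) {y : Fin N → ℝ}
    (hy : ∀ i, y i ∈ Icc (a i.castSucc) (a i.succ) ∧ f i (y i) = t) :
    ∑ i, (f' i (y i))⁻¹ = 1 := by
  have hex : ∀ i, ∀ s : ℝ, ∃ x, s ∈ Icc (0 : ℝ) 1 →
      x ∈ Icc (a i.castSucc) (a i.succ) ∧ f i x = s := fun i s => by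
    by_cases hs : s ∈ Icc (0 : ℝ) 1
    · obtain ⟨x, hx⟩ := (hf i).exists_eq (ha i.castSucc_lt_succ).le hs
      exact ⟨x, fun _ => hx⟩
    · exact ⟨0, fun h => absurd h hs⟩
  choose h hh using hex
  have hyh : ∀ i, h i t = y i := fun i =>
    (hf i).strictMonoOn.injOn (hh i t ht).1 (hy i).1 ((hh i t ht).2.trans (hy i).2.symm)
  have hsum : HasDerivWithinAt (fun s => ∑ i, (h i s - a i.castSucc)) (∑ i, (f' i (y i))⁻¹)
      (Icc 0 1) t := HasDerivWithinAt.fun_sum fun i _ => by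
    simpa only [hyh] using
      ((hf i).hasDerivWithinAt_rightInverse (hh i) ht).sub_const (a i.castSucc)
  have hid : HasDerivWithinAt (fun s => ∑ i, (h i s - a i.castSucc)) 1 (Icc 0 1) t :=
    (hasDerivWithinAt_id t _).congr_of_mem
      (fun s hs => sum_preimage_sub_eq ha ha0 haN hf hF hpres hs fun i => hh i s hs) ht
  exact (uniqueDiffOn_Icc zero_lt_one t ht).eq_deriv _ hsum hid

/-- ODE for the missing branch: under the extension condition, the
unique expanding branch `g` on `I_{i₀}` making the full branch map preserve
Lebesgue measure satisfies `g(a_{i₀-1}) = 0` and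
`g'(x) = (1 - ∑_{i ≠ i₀} 1 / fᵢ'(fᵢ⁻¹(g x)))⁻¹` on `I_{i₀}`. -/
theorem missing_branch_ode (n : ℕ)
    (a : Fin (n + 3) → ℝ) (ha : StrictMono a) (ha0 : a 0 = 0)
    (haN : a (Fin.last (n + 2)) = 1)
    (i₀ : Fin (n + 2)) (f f' : Fin (n + 2) → ℝ → ℝ)
    (hbranch : ∀ i : Fin (n + 2), i ≠ i₀ →
      IsBranch (a i.castSucc) (a i.succ) (f i) (f' i))
    (hsum : ∀ x ∈ Set.Icc (0 : ℝ) 1, ∀ y : Fin (n + 2) → ℝ,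
      (∀ i, i ≠ i₀ → y i ∈ Set.Icc (a i.castSucc) (a i.succ) ∧ f i (y i) = x) →
      ∑ i ∈ Finset.univ.erase i₀, 1 / f' i (y i) < 1)
    (g g' : ℝ → ℝ)
    (hg : IsBranch (a i₀.castSucc) (a i₀.succ) g g')
    (hpres : ∀ F : ℝ → ℝ, AgreesWith a (Function.update f i₀ g) F → PreservesLeb F) :
    g (a i₀.castSucc) = 0 ∧
    ∀ x ∈ Set.Icc (a i₀.castSucc) (a i₀.succ), ∀ y : Fin (n + 2) → ℝ,
      (∀ i, i ≠ i₀ → y i ∈ Set.Icc (a i.castSucc) (a i.succ) ∧ f i (y i) = g x) →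
      g' x = (1 - ∑ i ∈ Finset.univ.erase i₀, 1 / f' i (y i))⁻¹ := by
  refine ⟨hg.2.2.2.1, fun x hx y hy => ?_⟩
  have hf : ∀ i, IsBranch (a i.castSucc) (a i.succ) (Function.update f i₀ g i)
      (Function.update f' i₀ g' i) := fun i => by
    rcases eq_or_ne i i₀ with rfl | hi
    · simpa using hg
    · simpa [hi] using hbranch i hi
  have hgx : g x ∈ Icc (0 : ℝ) 1 := by
    have hle := hx.1.trans hx.2
    rw [← hg.2.2.2.1, ← hg.2.2.2.2]
    exact ⟨hg.strictMonoOn.monotoneOn (left_mem_Icc.2 hle) hx hx.1,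
      hg.strictMonoOn.monotoneOn hx (right_mem_Icc.2 hle) hx.2⟩
  have hy' : ∀ i, Function.update y i₀ x i ∈ Icc (a i.castSucc) (a i.succ) ∧
      Function.update f i₀ g i (Function.update y i₀ x i) = g x := fun i => by
    rcases eq_or_ne i i₀ with rfl | hi
    · simpa using hx
    · simpa [hi] using hy i hi
  obtain ⟨F, hF⟩ := exists_agreesWith ha.monotone haN (Function.update f i₀ g)
  have hsum_eq := sum_inv_deriv_eq_one ha ha0 haN hf hF (hpres F hF) hgx hy'
  rw [← Finset.add_sum_erase _ _ (Finset.mem_univ i₀), Finset.sum_congr rfl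
    (g := fun i => 1 / f' i (y i)) fun i hi => by simp [Finset.ne_of_mem_erase hi]] at hsum_eq
  simp only [Function.update_self] at hsum_eq
  rw [← eq_sub_of_add_eq hsum_eq, inv_inv]
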